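/- arXiv:2604.13707 — 3 statements merged into one kernel-verified Lean document; each statement's English description precedes it below -/
import Mathlib

section
/- Let F ∈ ℝ^{w×g}, Π_u ∈ ℝ^{u×w}, F_p ∈ ℝ^{g×g}, F_f ∈ ℝ^{g×d}, F_z ∈ ℝ^{g×u} be real matrices such that the u×u matrix Π_u F F_z is invertible. Suppose vectors e, e₀ ∈ ℝ^g, Δd ∈ ℝ^d, z ∈ ℝ^u satisfy e = F_p e₀ + F_f Δd + F_z z, and set Δu := Π_u F e. Then e = 𝓔_p e₀ + 𝓔_f Δd + 𝓔_u Δu, where 𝓔_p = (I − F_z (Π_u F F_z)^{-1} Π_u F) F_p, 𝓔_f = (I − F_z (Π_u F F_z)^{-1} Π_u F) F_f, and 𝓔_u = F_z (Π_u F F_z)^{-1}. -/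
open Matrix

/-- Matrix-algebra content of the paper's Lemma 2: decomposition of the prior
estimation error dynamics in terms of the input uncertainty `Δu`. -/
theorem stmt_0 {w g u d : ℕ}
    (F : Matrix (Fin w) (Fin g) ℝ) (Pu : Matrix (Fin u) (Fin w) ℝ)
    (Fp : Matrix (Fin g) (Fin g) ℝ) (Ff : Matrix (Fin g) (Fin d) ℝ)
    (Fz : Matrix (Fin g) (Fin u) ℝ)
    (hinv : IsUnit (Pu * F * Fz))
    (e e₀ : Fin g → ℝ) (Δd : Fin d → ℝ) (z : Fin u → ℝ)
    (he : e = Fp *ᵥ e₀ + Ff *ᵥ Δd + Fz *ᵥ z)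
    (Δu : Fin u → ℝ) (hΔu : Δu = (Pu * F) *ᵥ e) :
    e = ((1 - Fz * (Pu * F * Fz)⁻¹ * (Pu * F)) * Fp) *ᵥ e₀
      + ((1 - Fz * (Pu * F * Fz)⁻¹ * (Pu * F)) * Ff) *ᵥ Δd
      + (Fz * (Pu * F * Fz)⁻¹) *ᵥ Δu := by
  have hdet : IsUnit (Pu * F * Fz).det := (Matrix.isUnit_iff_isUnit_det _).1 hinv
  have hG : (Fz * (Pu * F * Fz)⁻¹ * (Pu * F)) * Fz = Fz := by
    rw [Matrix.mul_assoc, Matrix.mul_assoc, Matrix.nonsing_inv_mul _ hdet, Matrix.mul_one]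
  have hGz : (Fz * (Pu * F * Fz)⁻¹ * (Pu * F)) *ᵥ (Fz *ᵥ z) = Fz *ᵥ z := by
    rw [Matrix.mulVec_mulVec, hG]
  have hu : (Fz * (Pu * F * Fz)⁻¹) *ᵥ Δu = (Fz * (Pu * F * Fz)⁻¹ * (Pu * F)) *ᵥ e := by
    rw [hΔu, Matrix.mulVec_mulVec]
  rw [hu]
  generalize Fz * (Pu * F * Fz)⁻¹ * (Pu * F) = G at hGz ⊢
  rw [← Matrix.mulVec_mulVec, ← Matrix.mulVec_mulVec, Matrix.sub_mulVec, Matrix.sub_mulVec,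
    Matrix.one_mulVec, Matrix.one_mulVec, he, Matrix.mulVec_add, Matrix.mulVec_add, hGz]
  abel
end

section
/- Let P ∈ ℝ^{n×n} and S ∈ ℝ^{p×p} be symmetric matrices and let H ∈ ℝ^{p×n} be such that M := H P Hᵀ + S is invertible. Define K* := P Hᵀ M^{-1}. Then for every K ∈ ℝ^{n×p}, tr((I − K H) P (I − K H)ᵀ + K S Kᵀ) = tr((I − K* H) P) + tr((K − K*) M (K − K*)ᵀ). -/
open Matrix

/-- Completion-of-squares identity underlying the optimality of the filtering
gain: the excess cost of any gain `K` over the optimal `K*` equals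
`tr((K − K*) M (K − K*)ᵀ)`. -/
theorem stmt_6 {n p : ℕ}
    (P : Matrix (Fin n) (Fin n) ℝ) (S : Matrix (Fin p) (Fin p) ℝ)
    (H : Matrix (Fin p) (Fin n) ℝ)
    (hP : P.IsSymm) (hS : S.IsSymm)
    (M : Matrix (Fin p) (Fin p) ℝ) (hM : M = H * P * Hᵀ + S)
    (hinv : IsUnit M)
    (Kstar : Matrix (Fin n) (Fin p) ℝ) (hK : Kstar = P * Hᵀ * M⁻¹) :
    ∀ K : Matrix (Fin n) (Fin p) ℝ,
      ((1 - K * H) * P * (1 - K * H)ᵀ + K * S * Kᵀ).trace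
        = ((1 - Kstar * H) * P).trace
          + ((K - Kstar) * M * (K - Kstar)ᵀ).trace := by
  intro K
  have h1 : Kstar * M = P * Hᵀ := by
    rw [hK, Matrix.mul_assoc, Matrix.nonsing_inv_mul _ ((Matrix.isUnit_iff_isUnit_det M).1 hinv),
      Matrix.mul_one]
  have hMs : Mᵀ = M := by
    rw [hM]
    simp [Matrix.transpose_mul, hP.eq, hS.eq, Matrix.mul_assoc]
  have h2 : M * Kstarᵀ = H * P := by
    have h := congrArg Matrix.transpose h1
    simpa [Matrix.transpose_mul, hMs, hP.eq] using h
  have e1 : (1 - K * H) * P * (1 - K * H)ᵀ + K * S * Kᵀ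
      = P - K * (H * P) - P * Hᵀ * Kᵀ + K * M * Kᵀ := by
    rw [hM]
    simp only [Matrix.transpose_sub, Matrix.transpose_one, Matrix.transpose_mul, Matrix.sub_mul,
      Matrix.mul_sub, Matrix.mul_add, Matrix.add_mul, Matrix.one_mul, Matrix.mul_one,
      Matrix.mul_assoc]
    abel
  have e2 : (K - Kstar) * M * (K - Kstar)ᵀ
      = K * M * Kᵀ - K * (H * P) - P * Hᵀ * Kᵀ + Kstar * (H * P) := by
    rw [← h2, ← h1]
    simp only [Matrix.transpose_sub, Matrix.sub_mul, Matrix.mul_sub, Matrix.mul_assoc]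
    abel
  rw [← Matrix.trace_add, e1, e2, Matrix.sub_mul, Matrix.one_mul, Matrix.mul_assoc Kstar H P]
  congr 1
  abel
end

section
/- Let M ∈ ℝ^{n×n} be symmetric positive definite with W := M^{-1}, let A ∈ ℝ^{p×n}, B ∈ ℝ^{n×n}, C ∈ ℝ^{n×m}, and let γ ∈ ℝ. Then the following are equivalent: (i) for all g ∈ ℝ^n and d ∈ ℝ^m, gᵀ M g + γ² ‖d‖² − ‖A g‖² − (B g + C d)ᵀ M (B g + C d) ≥ 0; (ii) the symmetric block matrix [[W, 0, W Aᵀ, W Bᵀ], [0, γ² I, 0, Cᵀ], [A W, 0, I, 0], [B W, C, 0, W]] is positive semidefinite. -/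
open Matrix

/-- The quadratic form of the block matrix, completed to squares. -/
lemma stmt_9_form {n m p : ℕ}
    {M : Matrix (Fin n) (Fin n) ℝ} (hMt : Mᵀ = M)
    (A : Matrix (Fin p) (Fin n) ℝ) (B : Matrix (Fin n) (Fin n) ℝ)
    (C : Matrix (Fin n) (Fin m) ℝ) (γ : ℝ)
    (W : Matrix (Fin n) (Fin n) ℝ) (hWM : W * M = 1)
    (g k : Fin n → ℝ) (d : Fin m → ℝ) (y : Fin p → ℝ) :
    (Sum.elim (Sum.elim (M *ᵥ g) d) (Sum.elim y (M *ᵥ k))) ⬝ᵥ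
      ((Matrix.fromBlocks
        (Matrix.fromBlocks W 0 0 (γ ^ 2 • (1 : Matrix (Fin m) (Fin m) ℝ)))
        (Matrix.fromBlocks (W * Aᵀ) (W * Bᵀ) 0 Cᵀ)
        (Matrix.fromBlocks (A * W) 0 (B * W) C)
        (Matrix.fromBlocks 1 0 0 W)) *ᵥ
        (Sum.elim (Sum.elim (M *ᵥ g) d) (Sum.elim y (M *ᵥ k)))) =
    (g ⬝ᵥ (M *ᵥ g) + γ ^ 2 * (d ⬝ᵥ d) - (A *ᵥ g) ⬝ᵥ (A *ᵥ g)
          - (B *ᵥ g + C *ᵥ d) ⬝ᵥ (M *ᵥ (B *ᵥ g + C *ᵥ d)))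
      + (y + A *ᵥ g) ⬝ᵥ (y + A *ᵥ g)
      + (k + (B *ᵥ g + C *ᵥ d)) ⬝ᵥ (M *ᵥ (k + (B *ᵥ g + C *ᵥ d))) := by
  have hW1 : ∀ v, W *ᵥ (M *ᵥ v) = v := fun v => by
    rw [mulVec_mulVec, hWM, one_mulVec]
  have hMs : ∀ v w : Fin n → ℝ, v ⬝ᵥ (M *ᵥ w) = w ⬝ᵥ (M *ᵥ v) := fun v w => by
    rw [dotProduct_mulVec, ← mulVec_transpose, hMt, dotProduct_comm]
  have hMW : M * W = 1 := mul_eq_one_comm.mp hWM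
  have hMl : ∀ v w : Fin n → ℝ, (M *ᵥ v) ⬝ᵥ (W *ᵥ w) = v ⬝ᵥ w := fun v w => by
    rw [dotProduct_comm, hMs, mulVec_mulVec, hMW, one_mulVec]
  have hA : ∀ v w, v ⬝ᵥ (Aᵀ *ᵥ w) = w ⬝ᵥ (A *ᵥ v) := fun v w => by
    rw [mulVec_transpose, dotProduct_comm, dotProduct_mulVec]
  have hB : ∀ v w, v ⬝ᵥ (Bᵀ *ᵥ w) = w ⬝ᵥ (B *ᵥ v) := fun v w => by
    rw [mulVec_transpose, dotProduct_comm, dotProduct_mulVec]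
  have hC : ∀ v w, v ⬝ᵥ (Cᵀ *ᵥ w) = w ⬝ᵥ (C *ᵥ v) := fun v w => by
    rw [mulVec_transpose, dotProduct_comm, dotProduct_mulVec]
  simp only [fromBlocks_mulVec, Sum.elim_comp_inl, Sum.elim_comp_inr,
    sumElim_dotProduct_sumElim, dotProduct_add, add_dotProduct, mulVec_add, ← mulVec_mulVec,
    zero_mulVec, one_mulVec, smul_mulVec, dotProduct_smul, hW1, hMl, hA, hB, hC,
    smul_eq_mul, add_zero, zero_add, ← Sum.elim_add_add]
  have c : ∀ v w : Fin n → ℝ, (M *ᵥ v) ⬝ᵥ w = v ⬝ᵥ (M *ᵥ w) := fun v w => by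
    rw [dotProduct_comm, hMs]
  simp only [c]
  rw [hMs (B *ᵥ g) k, hMs (C *ᵥ d) k, hMs (C *ᵥ d) (B *ᵥ g), dotProduct_comm (A *ᵥ g) y]
  ring

/-- Equivalence between the quadratic dissipation inequality (eq. (nominalDiss))
and the LMI (eq. (dissConGeneral)) in the paper's Theorem 1. -/
theorem stmt_9 {n m p : ℕ}
    {M : Matrix (Fin n) (Fin n) ℝ} (hM : M.PosDef)
    (A : Matrix (Fin p) (Fin n) ℝ) (B : Matrix (Fin n) (Fin n) ℝ)
    (C : Matrix (Fin n) (Fin m) ℝ) (γ : ℝ)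
    (W : Matrix (Fin n) (Fin n) ℝ) (hW : W = M⁻¹) :
    (∀ (g : Fin n → ℝ) (d : Fin m → ℝ),
        0 ≤ g ⬝ᵥ (M *ᵥ g) + γ ^ 2 * (d ⬝ᵥ d) - (A *ᵥ g) ⬝ᵥ (A *ᵥ g)
          - (B *ᵥ g + C *ᵥ d) ⬝ᵥ (M *ᵥ (B *ᵥ g + C *ᵥ d))) ↔
      (Matrix.fromBlocks
        (Matrix.fromBlocks W 0 0 (γ ^ 2 • (1 : Matrix (Fin m) (Fin m) ℝ)))
        (Matrix.fromBlocks (W * Aᵀ) (W * Bᵀ) 0 Cᵀ)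
        (Matrix.fromBlocks (A * W) 0 (B * W) C)
        (Matrix.fromBlocks 1 0 0 W)).PosSemidef := by
  have hMt : Mᵀ = M := by simpa using hM.isHermitian.eq
  have hu : IsUnit M.det := (Matrix.isUnit_iff_isUnit_det M).mp hM.isUnit
  have hWM : W * M = 1 := by rw [hW, nonsing_inv_mul _ hu]
  have hMW : M * W = 1 := mul_eq_one_comm.mp hWM
  have hWt : Wᵀ = W := by rw [hW, transpose_nonsing_inv, hMt]
  have key := stmt_9_form hMt A B C γ W hWM
  have hpos : ∀ v, 0 ≤ v ⬝ᵥ (M *ᵥ v) := fun v => by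
    simpa using hM.posSemidef.dotProduct_mulVec_nonneg v
  constructor
  · intro h
    refine PosSemidef.of_dotProduct_mulVec_nonneg ?_ ?_
    · simp [IsHermitian, conjTranspose_eq_transpose_of_trivial, fromBlocks_transpose, hWt]
    · intro x
      have hx : x = Sum.elim (Sum.elim (M *ᵥ (W *ᵥ fun i => x (.inl (.inl i))))
          (fun i => x (.inl (.inr i)))) (Sum.elim (fun i => x (.inr (.inl i)))
          (M *ᵥ (W *ᵥ fun i => x (.inr (.inr i))))) := by
        simp only [mulVec_mulVec, hMW, one_mulVec]
        ext i
        rcases i with (i | i) | (i | i) <;> rfl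
      rw [star_trivial, hx, key]
      exact add_nonneg (add_nonneg (h _ _) (Finset.sum_nonneg fun i _ => mul_self_nonneg _))
        (hpos _)
  · intro h g d
    have := h.dotProduct_mulVec_nonneg
      (Sum.elim (Sum.elim (M *ᵥ g) d) (Sum.elim (-(A *ᵥ g)) (M *ᵥ (-(B *ᵥ g + C *ᵥ d)))))
    rw [star_trivial, key] at this
    simpa only [neg_add_cancel, zero_dotProduct, add_zero] using this
end
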